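/- Let I be a finite index set with at least two elements, let f : I → ℝ be real scores and n : I → ℝ with n_i > 0 for all i ∈ I. For each i ∈ I set s_i = Σ_{k ∈ I, k ≠ i} 1/n_k, and define the weights w_{i,j} = (1/n_j)/s_i for j ≠ i and W_i = s_i / n_i. Then the weighted contrastive loss dominates the logistic AUC loss: Σ_{i ∈ I} W_i · ( − log( e^{f_i} / ( e^{f_i} + Σ_{j ∈ I, j ≠ i} w_{i,j} · e^{f_j} ) ) ) ≥ Σ_{i ∈ I} Σ_{j ∈ I, j ≠ i} (1/(n_i · n_j)) · ( − log( 1 / (1 + e^{f_j − f_i}) ) ). -/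

import Mathlib

open Finset

/-- Jensen's inequality for the logarithm: the weighted softmax loss dominates the weighted average
of pairwise logistic losses. -/
theorem sum_mul_neg_log_logistic_le_neg_log_softmax {ι : Type*} (s : Finset ι) (w g : ι → ℝ)
    (a : ℝ) (hw : ∀ j ∈ s, 0 ≤ w j) (hw1 : ∑ j ∈ s, w j = 1) :
    ∑ j ∈ s, w j * (- Real.log (1 / (1 + Real.exp (g j - a)))) ≤
      - Real.log (Real.exp a / (Real.exp a + ∑ j ∈ s, w j * Real.exp (g j))) := by
  have hmean : ∑ j ∈ s, w j * (1 + Real.exp (g j - a)) =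
      (Real.exp a + ∑ j ∈ s, w j * Real.exp (g j)) / Real.exp a := by
    simp_rw [mul_add, mul_one, sum_add_distrib, hw1, Real.exp_sub, ← mul_div_assoc, ← sum_div]
    rw [add_div, div_self (Real.exp_pos a).ne']
  have hjensen := strictConcaveOn_log_Ioi.concaveOn.le_map_sum
    (p := fun j => 1 + Real.exp (g j - a)) hw hw1
    (fun j _ => Set.mem_Ioi.2 (by positivity))
  simp only [smul_eq_mul, hmean] at hjensen
  simpa only [← Real.log_inv, one_div, inv_inv, inv_div] using hjensen

/-- The weighted contrastive loss dominates the one-vs-one logistic AUC loss. -/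
theorem weighted_contrastive_ge_logistic_auc {I : Type*} [Fintype I] [DecidableEq I]
    (hcard : 2 ≤ Fintype.card I) (f n : I → ℝ) (hn : ∀ i, 0 < n i) :
    ∑ i, ((∑ k ∈ univ.erase i, 1 / n k) / n i) *
        (- Real.log (Real.exp (f i) /
          (Real.exp (f i) +
            ∑ j ∈ univ.erase i,
              ((1 / n j) / (∑ k ∈ univ.erase i, 1 / n k)) * Real.exp (f j)))) ≥
      ∑ i, ∑ j ∈ univ.erase i,
        (1 / (n i * n j)) * (- Real.log (1 / (1 + Real.exp (f j - f i)))) := by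
  refine sum_le_sum fun i _ => ?_
  have hne : (univ.erase i).Nonempty := by
    rw [← card_pos, card_erase_of_mem (mem_univ i), card_univ]
    omega
  have hs : 0 < ∑ k ∈ univ.erase i, 1 / n k :=
    sum_pos (fun k _ => one_div_pos.2 (hn k)) hne
  have hpair := sum_mul_neg_log_logistic_le_neg_log_softmax (univ.erase i)
    (fun j => (1 / n j) / (∑ k ∈ univ.erase i, 1 / n k)) f (f i)
    (fun j _ => div_nonneg (one_div_nonneg.2 (hn j).le) hs.le)
    (by rw [← sum_div, div_self hs.ne'])
  refine le_trans (le_of_eq ?_)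
    (mul_le_mul_of_nonneg_left hpair (div_nonneg hs.le (hn i).le))
  rw [mul_sum]
  refine sum_congr rfl fun j _ => ?_
  rw [← mul_assoc]
  congr 1
  generalize ∑ k ∈ univ.erase i, 1 / n k = S at hs ⊢
  have hi := (hn i).ne'
  have hj := (hn j).ne'
  field_simp
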